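/- Let ν = (ν_1 > ν_2 > ⋯ > ν_r > 0) be a strict partition of length r ≤ n and define the K-theoretic Q-polynomial GQ_ν(x_n) := Σ_{w∈C(r,n)} w·( ∏_{i=1}^{r} (x_i ⊕ x_i) x_i^{ν_i−1} · ∏_{i=1}^{r} ∏_{j=i+1}^{n} (x_i ⊕ x_j)/(x_i ⊖ x_j) ). Then GQ_ν(x_n) = [u_1^{−ν_1}⋯u_r^{−ν_r}]( ∏_{i=1}^{r} ( (1/(1+βu_i)) ∏_{j=1}^{n} (u_i ⊕ x_j)/(u_i ⊖ x_j) ) · ∏_{1≤i<j≤r} (u_j ⊖ u_i)/(u_j ⊕ u_i) ), the coefficient being taken in Λ[[β]]. This is the multiplicative specialization of the generating-function theorem for the universal Schur Q-functions. -/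

import Mathlib

open Finset

noncomputable section

instance finWF (r : ℕ) : WellFoundedLT (Fin r) :=
  inferInstanceAs (IsWellFounded (Fin r) (· < ·))

/-- The field `ℚ(x_1, …, x_n)` of rational functions. -/
abbrev K (n : ℕ) : Type := FractionRing (MvPolynomial (Fin n) ℚ)

/-- The indeterminate `x_i` (`0`-indexed). -/
def x (n : ℕ) (i : Fin n) : K n :=
  algebraMap (MvPolynomial (Fin n) ℚ) (K n) (MvPolynomial.X i)

/-- The coset representatives `C(r,n)`. -/
def Cperm (r n : ℕ) : Finset (Equiv.Perm (Fin n)) :=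
  Finset.univ.filter fun w => ∀ i j : Fin n, r ≤ (i : ℕ) → i < j → w i < w j

/-- The ring `Λ[[β]]`, where `Λ = K((u_1⁻¹))⋯((u_r⁻¹))`, realized inside the Hahn series
field over the lexicographically ordered group `ℤ^{r+1}` (coordinate `0` is the exponent of
the power series variable `β` and is the most significant). -/
abbrev H (n r : ℕ) := HahnSeries (Lex (Fin (r + 1) → ℤ)) (K n)

/-- The formal power series variable `β`. -/
def β (n r : ℕ) : H n r :=
  HahnSeries.single (toLex (Pi.single (0 : Fin (r + 1)) (1 : ℤ))) 1

/-- The variable `u_i` (`0`-indexed). -/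
def u (n r : ℕ) (i : Fin r) : H n r :=
  HahnSeries.single (toLex (Pi.single (Fin.succ (Fin.rev i)) (-1 : ℤ))) 1

/-- The formal sum `a ⊕ b = a + b + βab`. -/
def fplus (n r : ℕ) (a c : H n r) : H n r := a + c + β n r * a * c

/-- The formal difference `a ⊖ b = (a − b)/(1 + βb)`. -/
def fminus (n r : ℕ) (a c : H n r) : H n r := (a - c) / (1 + β n r * c)

/-- The image of a rational function in the Hahn field. -/
abbrev CK {n r : ℕ} (a : K n) : H n r := HahnSeries.C a

/-- The exponent-vector of `β^d · u_1^{−g(1)} ⋯ u_r^{−g(r)}`. -/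
def eVec (r : ℕ) (d : ℤ) (g : Fin r → ℤ) : Lex (Fin (r + 1) → ℤ) :=
  toLex (Fin.cases d (fun j => g (Fin.rev j)))

section PartialFractions

variable {L : Type*} [Field L]

/-- `p` specializes to `q` under `t ↦ X`, where `p` lies in the ring `R` of regular elements and
`q` in the field `S` of constants. -/
def SpecializesTo (R : Subring L) (S : Subfield L) (t X p q : L) : Prop :=
  p ∈ R ∧ q ∈ S ∧ ∃ g ∈ R, p - q = (t - X) * g

namespace SpecializesTo

variable {R : Subring L} {S : Subfield L} {t X p q p' q' : L}

theorem const (hSR : S.toSubring ≤ R) (hp : p ∈ S) : SpecializesTo R S t X p p :=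
  ⟨hSR hp, hp, 0, R.zero_mem, by ring⟩

theorem self (ht : t ∈ R) (hX : X ∈ S) : SpecializesTo R S t X t X :=
  ⟨ht, hX, 1, R.one_mem, by ring⟩

theorem add (h : SpecializesTo R S t X p q) (h' : SpecializesTo R S t X p' q') :
    SpecializesTo R S t X (p + p') (q + q') := by
  obtain ⟨hp, hq, g, hg, e⟩ := h
  obtain ⟨hp', hq', g', hg', e'⟩ := h'
  exact ⟨R.add_mem hp hp', S.add_mem hq hq', g + g', R.add_mem hg hg',
    by linear_combination e + e'⟩

theorem neg (h : SpecializesTo R S t X p q) : SpecializesTo R S t X (-p) (-q) := by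
  obtain ⟨hp, hq, g, hg, e⟩ := h
  exact ⟨R.neg_mem hp, S.neg_mem hq, -g, R.neg_mem hg, by linear_combination -e⟩

theorem sub (h : SpecializesTo R S t X p q) (h' : SpecializesTo R S t X p' q') :
    SpecializesTo R S t X (p - p') (q - q') := by
  simpa only [sub_eq_add_neg] using h.add h'.neg

theorem mul (hSR : S.toSubring ≤ R) (h : SpecializesTo R S t X p q)
    (h' : SpecializesTo R S t X p' q') : SpecializesTo R S t X (p * p') (q * q') := by
  obtain ⟨hp, hq, g, hg, e⟩ := h
  obtain ⟨hp', hq', g', hg', e'⟩ := h'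
  exact ⟨R.mul_mem hp hp', S.mul_mem hq hq', p * g' + q' * g,
    R.add_mem (R.mul_mem hp hg') (R.mul_mem (hSR hq') hg), by
      linear_combination p * e' + q' * e⟩

theorem pow (hSR : S.toSubring ≤ R) (h : SpecializesTo R S t X p q) (m : ℕ) :
    SpecializesTo R S t X (p ^ m) (q ^ m) := by
  induction m with
  | zero => simpa using const hSR S.one_mem
  | succ m ih => simpa only [pow_succ] using ih.mul hSR h

theorem inv (hSR : S.toSubring ≤ R) (h : SpecializesTo R S t X p q) (hp0 : p ≠ 0) (hq0 : q ≠ 0)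
    (hp' : p⁻¹ ∈ R) : SpecializesTo R S t X p⁻¹ q⁻¹ := by
  obtain ⟨hp, hq, g, hg, e⟩ := h
  refine ⟨hp', S.inv_mem hq, -(p⁻¹ * q⁻¹ * g),
    R.neg_mem (R.mul_mem (R.mul_mem hp' (hSR (S.inv_mem hq))) hg), ?_⟩
  field_simp
  linear_combination -e

theorem prod (hSR : S.toSubring ≤ R) {ι : Type*} {A : Finset ι} {f g : ι → L}
    (h : ∀ i ∈ A, SpecializesTo R S t X (f i) (g i)) :
    SpecializesTo R S t X (∏ i ∈ A, f i) (∏ i ∈ A, g i) := by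
  classical
  induction A using Finset.induction_on with
  | empty => simpa using const hSR S.one_mem
  | insert a A ha ih =>
    rw [Finset.prod_insert ha, Finset.prod_insert ha]
    exact (h a (Finset.mem_insert_self a A)).mul hSR
      (ih fun i hi => h i (Finset.mem_insert_of_mem hi))

theorem sum (hSR : S.toSubring ≤ R) {ι : Type*} {A : Finset ι} {f g : ι → L}
    (h : ∀ i ∈ A, SpecializesTo R S t X (f i) (g i)) :
    SpecializesTo R S t X (∑ i ∈ A, f i) (∑ i ∈ A, g i) := by
  classical
  induction A using Finset.induction_on with
  | empty => simpa using const hSR S.zero_mem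
  | insert a A ha ih =>
    rw [Finset.sum_insert ha, Finset.sum_insert ha]
    exact (h a (Finset.mem_insert_self a A)).add
      (ih fun i hi => h i (Finset.mem_insert_of_mem hi))

end SpecializesTo

/-- Partial fraction expansion along simple constant poles, up to a regular element. -/
theorem exists_partial_fractions {R : Subring L} {S : Subfield L} (hSR : S.toSubring ≤ R)
    {ι : Type*} [DecidableEq ι] {t p : L} {X q : ι → L} {A : Finset ι} (ht : t ∈ R)
    (hX : ∀ a ∈ A, X a ∈ S) (hinj : ∀ a ∈ A, ∀ b ∈ A, X a = X b → a = b)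
    (htX : ∀ a ∈ A, t - X a ≠ 0) (hp : p ∈ R)
    (hpq : ∀ a ∈ A, SpecializesTo R S t (X a) p (q a)) :
    ∃ g ∈ R, p / ∏ b ∈ A, (t - X b) =
      ∑ a ∈ A, q a / (∏ b ∈ A.erase a, (X a - X b)) / (t - X a) + g := by
  set z : L := p - ∑ a ∈ A, q a * ∏ b ∈ A.erase a, ((t - X b) * (X a - X b)⁻¹) with hz
  have hzR : z ∈ R := by
    refine R.sub_mem hp (R.sum_mem fun a ha => R.mul_mem (hSR (hpq a ha).2.1)
      (R.prod_mem fun b hb => ?_))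
    have hb := Finset.mem_of_mem_erase hb
    exact R.mul_mem (R.sub_mem ht (hSR (hX b hb)))
      (hSR (S.inv_mem (S.sub_mem (hX a ha) (hX b hb))))
  have hspec : ∀ a ∈ A, SpecializesTo R S t (X a) z 0 := by
    intro a ha
    have h : SpecializesTo R S t (X a) z
        (q a - ∑ c ∈ A, q c * ∏ b ∈ A.erase c, ((X a - X b) * (X c - X b)⁻¹)) := by
      refine (hpq a ha).sub (SpecializesTo.sum hSR fun c hc => ?_)
      refine (SpecializesTo.const hSR (hpq c hc).2.1).mul hSR
        (SpecializesTo.prod hSR fun b hb => ?_)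
      have hb := Finset.mem_of_mem_erase hb
      exact ((SpecializesTo.self ht (hX a ha)).sub (SpecializesTo.const hSR (hX b hb))).mul hSR
        (SpecializesTo.const hSR (S.inv_mem (S.sub_mem (hX c hc) (hX b hb))))
    rw [Finset.sum_eq_single_of_mem a ha, Finset.prod_eq_one, mul_one, sub_self] at h
    · exact h
    · intro b hb
      refine mul_inv_cancel₀ (sub_ne_zero.2 fun e => ?_)
      exact Finset.ne_of_mem_erase hb (hinj a ha b (Finset.mem_of_mem_erase hb) e).symm
    · intro c _ hca
      rw [Finset.prod_eq_zero (i := a) (Finset.mem_erase.2 ⟨hca.symm, ha⟩) (by simp), mul_zero]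
  have hdvd : ∏ b ∈ A.attach, (⟨t - X b, R.sub_mem ht (hSR (hX b b.2))⟩ : R) ∣ ⟨z, hzR⟩ := by
    refine Finset.prod_dvd_of_coprime ?_ ?_
    · intro a _ b _ hab
      have hne : X b - X a ≠ 0 := sub_ne_zero.2 fun e =>
        hab (Subtype.ext (hinj b b.2 a a.2 e).symm)
      have hmem : (X b - X a)⁻¹ ∈ R := hSR (S.inv_mem (S.sub_mem (hX b b.2) (hX a a.2)))
      refine ⟨⟨_, hmem⟩, -⟨_, hmem⟩, Subtype.ext ?_⟩
      simp only [Subring.coe_add, Subring.coe_mul, Subring.coe_neg, Subring.coe_one]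
      field_simp
      ring
    · intro a _
      obtain ⟨-, -, g, hg, e⟩ := hspec a a.2
      exact ⟨⟨g, hg⟩, Subtype.ext (by simpa using e)⟩
  obtain ⟨⟨g, hg⟩, e⟩ := hdvd
  have e' : z = (∏ b ∈ A, (t - X b)) * g := by
    have := congrArg Subtype.val e
    rw [Subring.coe_mul, ← Subring.subtype_apply, ← Subring.subtype_apply, map_prod] at this
    simpa [Finset.prod_attach A fun b => t - X b] using this
  have hP : ∏ b ∈ A, (t - X b) ≠ 0 := Finset.prod_ne_zero_iff.2 htX
  refine ⟨g, hg, ?_⟩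
  rw [div_eq_iff hP, add_mul, mul_comm g, ← e', hz, Finset.sum_mul]
  rw [eq_comm, add_comm, sub_add_eq_add_sub, sub_eq_iff_eq_add]
  congr 1
  refine Finset.sum_congr rfl fun a ha => ?_
  have hta := htX a ha
  rw [← Finset.mul_prod_erase A _ ha, Finset.prod_mul_distrib, Finset.prod_inv_distrib]
  field_simp

end PartialFractions

section Support

variable {Γ F : Type*} [AddCommGroup Γ] [LinearOrder Γ] [IsOrderedAddMonoid Γ] [Field F]

/-- The Hahn series supported in an additive submonoid. -/
def supportedIn (P : AddSubmonoid Γ) : Subring (HahnSeries Γ F) where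
  carrier := {f | ∀ a, f.coeff a ≠ 0 → a ∈ P}
  zero_mem' a h := absurd (by simp) h
  one_mem' a h := by
    by_cases ha : a = 0
    · exact ha ▸ P.zero_mem
    · exact absurd (by simp [HahnSeries.coeff_one, ha]) h
  add_mem' {f g} hf hg a h := by
    by_cases hfa : f.coeff a = 0
    · exact hg a (by simpa [hfa] using h)
    · exact hf a hfa
  neg_mem' {f} hf a h := hf a (by simpa using h)
  mul_mem' {f g} hf hg a h := by
    obtain ⟨b, hb, c, hc, rfl⟩ := HahnSeries.support_mul_subset ((HahnSeries.mem_support _ _).2 h)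
    exact P.add_mem (hf b hb) (hg c hc)

theorem mem_supportedIn {P : AddSubmonoid Γ} {f : HahnSeries Γ F} :
    f ∈ supportedIn P ↔ ∀ a, f.coeff a ≠ 0 → a ∈ P := Iff.rfl

theorem single_mem_supportedIn {P : AddSubmonoid Γ} {a : Γ} (ha : a ∈ P) (c : F) :
    HahnSeries.single a c ∈ supportedIn P := by
  intro b hb
  by_cases h : b = a
  · exact h ▸ ha
  · exact absurd (HahnSeries.coeff_single_of_ne h) hb

theorem inv_mem_supportedIn {P : AddSubmonoid Γ} {f : HahnSeries Γ F} (hf : f ∈ supportedIn P)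
    {e : Γ} (he : f.coeff e ≠ 0) (hlt : ∀ a < e, f.coeff a = 0) (heP : -e ∈ P) :
    f⁻¹ ∈ supportedIn P := by
  by_contra hcon
  have hf0 : f ≠ 0 := by rintro rfl; simp at he
  set B : Set Γ := {m | f⁻¹.coeff m ≠ 0 ∧ m ∉ P} with hB
  have hBne : B.Nonempty := by
    rw [mem_supportedIn] at hcon
    push Not at hcon
    exact hcon
  have hwf : B.IsWF := f⁻¹.isWF_support.mono fun m hm => hm.1
  set m := hwf.min hBne with hm
  obtain ⟨hm0, hmP⟩ : m ∈ B := hwf.min_mem hBne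
  have hcoef : (f * f⁻¹).coeff (e + m) = f.coeff e * f⁻¹.coeff m := by
    rw [HahnSeries.coeff_mul]
    refine Finset.sum_eq_single_of_mem (e, m) ?_ ?_
    · simp [he, hm0]
    · rintro ⟨a, b⟩ hab hne
      rw [Finset.mem_antidiagonal] at hab
      obtain ⟨ha, hb, hsum⟩ := hab
      dsimp only at hsum
      simp only [HahnSeries.mem_support] at ha hb
      exfalso
      have hea : e < a := by
        refine lt_of_le_of_ne (not_lt.1 fun h => ha (hlt a h)) ?_
        rintro rfl
        exact hne (by rw [add_left_cancel hsum])
      have hbm : b < m := by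
        by_contra h
        exact absurd hsum (add_lt_add_of_lt_of_le hea (not_lt.1 h)).ne'
      have hbP : b ∈ P := by
        by_contra h
        exact hwf.not_lt_min hBne ⟨hb, h⟩ hbm
      refine hmP ?_
      have : m = -e + (a + b) := by rw [hsum]; abel
      rw [this]
      exact P.add_mem heP (P.add_mem (hf a ha) hbP)
  rw [mul_inv_cancel₀ hf0] at hcoef
  have h1 : e + m = 0 := by
    by_contra h
    rw [HahnSeries.coeff_one, if_neg h] at hcoef
    exact mul_ne_zero he hm0 hcoef.symm
  exact hmP (by rwa [← neg_eq_of_add_eq_zero_right h1])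

/-- The field of Hahn series whose exponents all have degree zero. -/
def constants (φ : Γ →+ ℤ) : Subfield (HahnSeries Γ F) where
  toSubring := supportedIn (AddMonoidHom.mker φ)
  inv_mem' f hf := by
    by_cases hf0 : f = 0
    · subst hf0
      simp
    have hc : f.coeff f.order ≠ 0 := by simpa using hf0
    refine inv_mem_supportedIn hf hc (fun a ha => HahnSeries.coeff_eq_zero_of_lt_order ha) ?_
    have := hf _ hc
    rw [AddMonoidHom.mem_mker] at this ⊢
    simp [this]

/-- The submonoid of exponents of nonpositive degree. -/
def nonposDeg (φ : Γ →+ ℤ) : AddSubmonoid Γ where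
  carrier := {a | φ a ≤ 0}
  zero_mem' := by simp
  add_mem' {a b} ha hb := by
    simp only [Set.mem_ofPred_eq, map_add] at *
    omega

theorem constants_le (φ : Γ →+ ℤ) :
    (constants (F := F) φ).toSubring ≤ supportedIn (nonposDeg φ) :=
  fun _ hf a ha => (hf a ha : φ a = 0).le

theorem C_mem_constants (φ : Γ →+ ℤ) (c : F) : HahnSeries.C c ∈ constants φ :=
  single_mem_supportedIn (AddMonoidHom.mker φ).zero_mem c

theorem single_sub_C_ne_zero {δ : Γ} (hδ : δ < 0) (c : F) :
    HahnSeries.single δ (1 : F) - HahnSeries.C c ≠ 0 := by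
  intro h
  have := congrArg (fun f => HahnSeries.coeff f δ) h
  simp [HahnSeries.C_apply, HahnSeries.coeff_single_of_ne hδ.ne] at this

/-- The coefficients of degree zero of a constant multiple of `1 / (1 - c / t)`. -/
theorem coeff_const_mul_div {φ : Γ →+ ℤ} {δ : Γ} (hδ : δ < 0) (hφ : φ δ = -1) (c : F)
    {f : HahnSeries Γ F} (hf : f ∈ constants φ) {e : Γ} (he : φ e = 0) :
    (f * (HahnSeries.single δ 1 / (HahnSeries.single δ 1 - HahnSeries.C c))).coeff e =
      f.coeff e := by
  set t : HahnSeries Γ F := HahnSeries.single δ 1 with ht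
  set s : HahnSeries Γ F := HahnSeries.single (-δ) 1 with hs
  have hts : t * s = 1 := by
    rw [ht, hs, HahnSeries.single_mul_single]
    simp
  have hne : t - HahnSeries.C c ≠ 0 := single_sub_C_ne_zero hδ c
  let T : AddSubmonoid Γ := nonposDeg (-φ)
  have hT : ∀ a, a ∈ T ↔ 0 ≤ φ a := fun a => by
    change -φ a ≤ 0 ↔ _
    omega
  have hsc : s * HahnSeries.C c = HahnSeries.single (-δ) c := by
    rw [hs, HahnSeries.C_apply, HahnSeries.single_mul_single]
    simp
  have hsT : HahnSeries.single (-δ) c ∈ supportedIn T :=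
    single_mem_supportedIn ((hT _).2 (by simp [hφ])) c
  have hinv : (1 - HahnSeries.single (-δ) c)⁻¹ ∈ supportedIn T := by
    refine inv_mem_supportedIn (e := 0) (Subring.sub_mem _ (Subring.one_mem _) hsT) ?_ ?_ ?_
    · rw [HahnSeries.coeff_sub, HahnSeries.coeff_single_of_ne (neg_pos.2 hδ).ne]
      simp
    · intro a ha
      rw [HahnSeries.coeff_sub, HahnSeries.coeff_single_of_ne (ha.trans (neg_pos.2 hδ)).ne,
        HahnSeries.coeff_one, if_neg ha.ne, sub_zero]
    · simp
  have hfac : t - HahnSeries.C c = t * (1 - HahnSeries.single (-δ) c) := by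
    rw [← hsc]
    linear_combination HahnSeries.C c * hts
  have ht0 : t ≠ 0 := left_ne_zero_of_mul_eq_one hts
  have h10 : 1 - HahnSeries.single (-δ) c ≠ 0 := by
    rintro h
    rw [h, mul_zero] at hfac
    exact hne hfac
  have hdecomp : f * (t / (t - HahnSeries.C c)) =
      f + s * (HahnSeries.C c * f * (1 - HahnSeries.single (-δ) c)⁻¹) := by
    rw [hfac, ← hsc] at *
    field_simp
    ring
  have hg : HahnSeries.C c * f * (1 - HahnSeries.single (-δ) c)⁻¹ ∈ supportedIn T := by
    refine Subring.mul_mem _ (Subring.mul_mem _ ?_ ?_) hinv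
    · exact single_mem_supportedIn T.zero_mem c
    · exact fun a ha => (hT a).2 (hf a ha : φ a = 0).ge
  rw [hdecomp, HahnSeries.coeff_add, add_eq_left]
  by_contra h
  rw [hs, HahnSeries.coeff_single_mul, one_mul] at h
  have := (hT _).1 (hg _ h)
  simp [he, hφ] at this

/-- Coefficient extraction by residues at simple constant poles. -/
theorem coeff_eq_sum_residues {φ : Γ →+ ℤ} {δ : Γ} (hδ : δ < 0) (hφ : φ δ = -1)
    {ι : Type*} [DecidableEq ι] {A : Finset ι} {ξ : ι → F} (hξ : Function.Injective ξ)
    {p : HahnSeries Γ F} {q : ι → HahnSeries Γ F} (hp : p ∈ supportedIn (nonposDeg φ))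
    (hpq : ∀ a ∈ A, SpecializesTo (supportedIn (nonposDeg φ)) (constants φ)
      (HahnSeries.single δ 1) (HahnSeries.C (ξ a)) p (q a)) {e : Γ} (he : φ e = 0) :
    (HahnSeries.single δ 1 *
      (p / ∏ b ∈ A, (HahnSeries.single δ 1 - HahnSeries.C (ξ b)))).coeff e =
    (∑ a ∈ A, q a / ∏ b ∈ A.erase a, (HahnSeries.C (ξ a) - HahnSeries.C (ξ b))).coeff e := by
  have hδR : HahnSeries.single δ (1 : F) ∈ supportedIn (nonposDeg φ) :=
    single_mem_supportedIn (show φ δ ≤ 0 by omega) 1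
  obtain ⟨g, hg, h⟩ := exists_partial_fractions (constants_le φ) (A := A)
    (X := fun a => HahnSeries.C (ξ a)) hδR (fun a _ => C_mem_constants φ _)
    (fun a _ b _ hab => hξ (HahnSeries.C_injective hab))
    (fun a _ => single_sub_C_ne_zero hδ _) hp hpq
  rw [h, mul_add, HahnSeries.coeff_add, Finset.mul_sum]
  have hg0 : (HahnSeries.single δ 1 * g).coeff e = 0 := by
    by_contra h0
    rw [HahnSeries.coeff_single_mul, one_mul] at h0
    have : φ (e - δ) ≤ 0 := hg _ h0
    rw [map_sub] at this
    omega
  rw [hg0, add_zero, HahnSeries.coeff_sum, HahnSeries.coeff_sum]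
  refine Finset.sum_congr rfl fun a ha => ?_
  rw [mul_div_left_comm]
  refine coeff_const_mul_div hδ hφ _ ?_ he
  exact Subfield.div_mem _ (hpq a ha).2.1 (Subfield.prod_mem _ fun b _ =>
    Subfield.sub_mem _ (C_mem_constants φ _) (C_mem_constants φ _))

end Support
section InjectiveSums

variable {X M : Type*} [DecidableEq X] [CommSemiring M]

/-- The sum over ordered selections without repetition of `s` elements of `A`; the factor `G i a B`
belongs to the selection of `a` at time `i` when the elements of `B` are left over. -/
def selectionSum (G : ℕ → X → Finset X → M) : ℕ → ℕ → Finset X → M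
  | 0, _, _ => 1
  | s + 1, k, A => ∑ a ∈ A, G k a (A.erase a) * selectionSum G s (k + 1) (A.erase a)

theorem selectionSum_eq_sum_injective [Fintype X] (G : ℕ → X → Finset X → M) (s k : ℕ)
    (A : Finset X) :
    selectionSum G s k A =
      ∑ f : Fin s → X with Function.Injective f ∧ ∀ i, f i ∈ A,
        ∏ i : Fin s, G (k + i) (f i) {b ∈ A | ∀ j ≤ i, b ≠ f j} := by
  induction s generalizing k A with
  | zero =>
    rw [Finset.filter_true_of_mem fun f _ =>
      ⟨Function.injective_of_subsingleton f, fun i => i.elim0⟩]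
    simp [selectionSum]
  | succ s ih =>
    rw [selectionSum]
    simp_rw [ih, Finset.mul_sum]
    rw [Finset.sum_sigma']
    refine Finset.sum_bij' (fun p _ => (Fin.cons p.1 p.2 : Fin (s + 1) → X))
      (fun f _ => ⟨f 0, Fin.tail f⟩) ?_ ?_ ?_ ?_ ?_
    · rintro ⟨a, f⟩ h
      simp only [Finset.mem_sigma, Finset.mem_filter, Finset.mem_univ, true_and,
        Finset.mem_erase] at h ⊢
      refine ⟨Fin.cons_injective_iff.2 ⟨?_, h.2.1⟩, Fin.cases h.1 fun i => (h.2.2 i).2⟩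
      rintro ⟨i, hi⟩
      exact (h.2.2 i).1 hi
    · intro f h
      simp only [Finset.mem_sigma, Finset.mem_filter, Finset.mem_univ, true_and,
        Finset.mem_erase] at h ⊢
      exact ⟨h.2 0, h.1.comp (Fin.succ_injective s),
        fun i => ⟨h.1.ne (Fin.succ_ne_zero i), h.2 _⟩⟩
    · rintro ⟨a, f⟩ _
      simp
    · intro f _
      simp
    · rintro ⟨a, f⟩ h
      rw [Fin.prod_univ_succ]
      congr 1
      · simp only [Fin.val_zero, add_zero, Fin.cons_zero]
        congr 1
        ext b
        simp only [Finset.mem_erase, Finset.mem_filter, Fin.le_zero_iff, forall_eq, Fin.cons_zero]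
        tauto
      · refine Finset.prod_congr rfl fun i _ => ?_
        simp only [Fin.cons_succ, Fin.val_succ]
        congr 1
        · omega
        · ext b
          simp only [Finset.mem_erase, Finset.mem_filter, Fin.forall_fin_succ, Fin.cons_zero,
            Fin.cons_succ, Fin.zero_le, forall_true_left, Fin.succ_le_succ_iff]
          tauto

end InjectiveSums

theorem sum_Cperm_eq_sum_injective {M : Type*} [AddCommMonoid M] {n r : ℕ} (hrn : r ≤ n)
    (g : (Fin r → Fin n) → M) :
    ∑ w ∈ Cperm r n, g (fun i => w (Fin.castLE hrn i)) =
      ∑ f : Fin r → Fin n with Function.Injective f, g f := by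
  obtain ⟨m, rfl⟩ := Nat.exists_eq_add_of_le hrn
  have hcastLE : ∀ i : Fin r, Fin.castLE hrn i = Fin.castAdd m i := fun _ => rfl
  have hcard : ∀ f : Fin r → Fin (r + m), Function.Injective f →
      (Finset.univ.image f)ᶜ.card = m := by
    intro f hf
    rw [Finset.card_compl, Finset.card_image_of_injective _ hf]
    simp
  have htail : ∀ w ∈ Cperm r (r + m),
      (∀ i : Fin m, w (Fin.natAdd r i) ∈
        (Finset.univ.image fun i : Fin r => w (Fin.castAdd m i))ᶜ) ∧
      StrictMono fun i : Fin m => w (Fin.natAdd r i) := by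
    intro w hw
    simp only [Cperm, Finset.mem_filter, Finset.mem_univ, true_and] at hw
    refine ⟨fun i => ?_, fun i j hij => hw _ _ (by simp) (by simpa using hij)⟩
    simp only [Finset.mem_compl, Finset.mem_image, Finset.mem_univ, true_and, not_exists]
    intro j hj
    have := congrArg Fin.val (w.injective hj)
    simp only [Fin.val_castAdd, Fin.val_natAdd] at this
    omega
  refine Finset.sum_bij (fun w _ i => w (Fin.castLE hrn i)) ?_ ?_ ?_ ?_
  · intro w _
    simp only [Finset.mem_filter, Finset.mem_univ, true_and]
    exact w.injective.comp (Fin.castLE_injective hrn)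
  · intro w hw w' hw' h
    simp only [hcastLE] at h
    have hinj : Function.Injective fun i : Fin r => w (Fin.castAdd m i) :=
      w.injective.comp (Fin.castAdd_injective r m)
    have h1 := Finset.orderEmbOfFin_unique (hcard _ hinj) (htail w hw).1 (htail w hw).2
    have h2 := Finset.orderEmbOfFin_unique (hcard _ hinj)
      (by rw [h]; exact (htail w' hw').1) (htail w' hw').2
    ext i : 1
    induction i using Fin.addCases with
    | left i => exact congrFun h i
    | right i => exact congrFun (h1.trans h2.symm) i
  · intro f hf
    simp only [Finset.mem_filter, Finset.mem_univ, true_and] at hf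
    set e := (Finset.univ.image f)ᶜ.orderEmbOfFin (hcard f hf) with he
    have hemem : ∀ i j, f i ≠ e j := by
      intro i j hij
      have := Finset.orderEmbOfFin_mem (Finset.univ.image f)ᶜ (hcard f hf) j
      rw [← he, ← hij] at this
      simp at this
    have hinj : Function.Injective (Fin.append f e) :=
      Fin.append_injective_iff.2 ⟨hf, e.injective, hemem⟩
    refine ⟨Equiv.ofBijective _ (Finite.injective_iff_bijective.1 hinj), ?_, ?_⟩
    · simp only [Cperm, Finset.mem_filter, Finset.mem_univ, true_and]
      intro i j hi hij
      induction i using Fin.addCases with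
      | left i => simp at hi; omega
      | right i =>
        induction j using Fin.addCases with
        | left j =>
          rw [Fin.lt_def] at hij
          simp at hij
          omega
        | right j =>
          simpa using hij
    · funext i
      rw [hcastLE]
      simp
  · intro w _
    rfl
section Exponents

variable {n r : ℕ}

/-- The exponent of the variable `u_i⁻¹`. -/
def uDeg (i : Fin r) : Lex (Fin (r + 1) → ℤ) →+ ℤ where
  toFun e := ofLex e (Fin.succ (Fin.rev i))
  map_zero' := rfl
  map_add' _ _ := rfl

/-- The exponent of `u_i`. -/
def uExp (i : Fin r) : Lex (Fin (r + 1) → ℤ) := toLex (Pi.single (Fin.succ (Fin.rev i)) (-1 : ℤ))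

/-- The exponent of `β`. -/
def βExp (r : ℕ) : Lex (Fin (r + 1) → ℤ) := toLex (Pi.single (0 : Fin (r + 1)) (1 : ℤ))

theorem u_eq (i : Fin r) : u n r i = HahnSeries.single (uExp i) 1 := rfl

theorem β_eq : β n r = HahnSeries.single (βExp r) 1 := rfl

@[simp]
theorem uDeg_uExp_self (i : Fin r) : uDeg i (uExp i) = -1 := by
  simp [uDeg, uExp]

theorem uDeg_uExp_of_ne {i j : Fin r} (h : i ≠ j) : uDeg i (uExp j) = 0 := by
  simp [uDeg, uExp, Fin.rev_inj, h]

@[simp]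
theorem uDeg_βExp (i : Fin r) : uDeg i (βExp r) = 0 := by
  simp [uDeg, βExp]

@[simp]
theorem uDeg_eVec (i : Fin r) (d : ℤ) (g : Fin r → ℤ) : uDeg i (eVec r d g) = g i := by
  simp [uDeg, eVec]

theorem toLex_lt_of_apply_lt {m : ℕ} {a b : Fin m → ℤ} (i : Fin m) (h : ∀ j < i, a j = b j)
    (hi : a i < b i) : toLex a < toLex b :=
  ⟨i, h, hi⟩

theorem uExp_neg (i : Fin r) : uExp i < 0 := by
  refine toLex_lt_of_apply_lt (b := 0) (Fin.succ (Fin.rev i)) (fun j hj => ?_) (by simp)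
  simp [Pi.single_eq_of_ne hj.ne]

theorem uExp_lt_uExp {i j : Fin r} (h : i < j) : uExp j < uExp i := by
  have hlt : (Fin.rev j).succ < (Fin.rev i).succ := by simpa using h
  refine toLex_lt_of_apply_lt (Fin.succ (Fin.rev j)) (fun l hl => ?_) ?_
  · rw [Pi.single_eq_of_ne hl.ne, Pi.single_eq_of_ne (hl.trans hlt).ne]
  · rw [Pi.single_eq_of_ne hlt.ne]
    simp

theorem βExp_add_uExp_pos (i : Fin r) : 0 < βExp r + uExp i := by
  refine toLex_lt_of_apply_lt (a := 0) (b := ofLex (βExp r + uExp i)) 0 (fun l hl => ?_) ?_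
  · exact absurd hl (Fin.not_lt_zero l)
  · change (0 : ℤ) < (Pi.single (0 : Fin (r + 1)) (1 : ℤ) : Fin (r + 1) → ℤ) 0 +
      (Pi.single (Fin.succ (Fin.rev i)) (-1 : ℤ) : Fin (r + 1) → ℤ) 0
    simp

theorem βExp_pos : 0 < βExp r := by
  refine toLex_lt_of_apply_lt (a := 0) 0 (fun l hl => ?_) ?_
  · exact absurd hl (Fin.not_lt_zero l)
  · simp

theorem eVec_add_nsmul_uExp (i : Fin r) (d : ℤ) (g : Fin r → ℤ) (m : ℕ) (h : g i = m) :
    m • uExp i + eVec r d g = eVec r d (Function.update g i 0) := by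
  apply ofLex.injective
  funext l
  change m • (Pi.single (Fin.succ (Fin.rev i)) (-1 : ℤ) : Fin (r + 1) → ℤ) l +
      (Fin.cases d (fun j => g (Fin.rev j)) l : ℤ) =
    (Fin.cases d (fun j => Function.update g i 0 (Fin.rev j)) l : ℤ)
  induction l using Fin.cases with
  | zero => simp
  | succ l =>
    obtain ⟨l, rfl⟩ := Fin.rev_surjective l
    by_cases hl : l = i
    · subst hl
      simp [h]
    · simp [hl, Fin.rev_inj]

theorem β_mem_constants (i : Fin r) : β n r ∈ constants (uDeg i) :=
  single_mem_supportedIn (uDeg_βExp i) 1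

theorem u_mem_constants {i j : Fin r} (h : i ≠ j) : u n r j ∈ constants (uDeg i) :=
  single_mem_supportedIn (uDeg_uExp_of_ne h) 1

theorem u_mem_supportedIn (i : Fin r) : u n r i ∈ supportedIn (nonposDeg (uDeg i)) :=
  single_mem_supportedIn (show uDeg i (uExp i) ≤ 0 by simp) 1

theorem fplus_mem_constants {i : Fin r} {a c : H n r} (ha : a ∈ constants (uDeg i))
    (hc : c ∈ constants (uDeg i)) : fplus n r a c ∈ constants (uDeg i) :=
  add_mem (add_mem ha hc) (mul_mem (mul_mem (β_mem_constants i) ha) hc)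

theorem one_add_β_mul_mem_constants {i : Fin r} {c : H n r} (hc : c ∈ constants (uDeg i)) :
    1 + β n r * c ∈ constants (uDeg i) :=
  add_mem (one_mem _) (mul_mem (β_mem_constants i) hc)

theorem fminus_mem_constants {i : Fin r} {a c : H n r} (ha : a ∈ constants (uDeg i))
    (hc : c ∈ constants (uDeg i)) : fminus n r a c ∈ constants (uDeg i) :=
  div_mem (sub_mem ha hc) (one_add_β_mul_mem_constants hc)

theorem one_add_single_coeff_zero {e : Lex (Fin (r + 1) → ℤ)} (he : 0 < e) (c : K n) :
    (1 + HahnSeries.single e c : H n r).coeff 0 = 1 := by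
  rw [HahnSeries.coeff_add, HahnSeries.coeff_single_of_ne he.ne]
  simp

theorem β_mul_u (i : Fin r) : β n r * u n r i = HahnSeries.single (βExp r + uExp i) 1 := by
  rw [u_eq, β_eq, HahnSeries.single_mul_single, one_mul]

theorem β_mul_C (c : K n) : β n r * HahnSeries.C c = HahnSeries.single (βExp r) c := by
  rw [β_eq, HahnSeries.C_apply, HahnSeries.single_mul_single, one_mul, add_zero]

theorem one_add_β_mul_u_ne_zero (i : Fin r) : 1 + β n r * u n r i ≠ 0 := by
  intro h
  have := one_add_single_coeff_zero (n := n) (βExp_add_uExp_pos i) 1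
  rw [← β_mul_u, h] at this
  simp at this

theorem one_add_β_mul_C_ne_zero (c : K n) : 1 + β n r * HahnSeries.C c ≠ 0 := by
  intro h
  have := one_add_single_coeff_zero (n := n) (βExp_pos (r := r)) c
  rw [← β_mul_C, h] at this
  simp at this

theorem inv_one_add_β_mul_u_mem (i : Fin r) :
    (1 + β n r * u n r i)⁻¹ ∈ supportedIn (nonposDeg (uDeg i)) := by
  refine inv_mem_supportedIn (e := 0) (add_mem (one_mem _)
    (mul_mem (constants_le _ (β_mem_constants i)) (u_mem_supportedIn i))) ?_ ?_ ?_
  · rw [β_mul_u, one_add_single_coeff_zero (βExp_add_uExp_pos i)]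
    exact one_ne_zero
  · intro a ha
    rw [β_mul_u, HahnSeries.coeff_add, HahnSeries.coeff_one, if_neg ha.ne,
      HahnSeries.coeff_single_of_ne (ha.trans (βExp_add_uExp_pos i)).ne, add_zero]
  · simp

theorem fplus_u_u (i j : Fin r) : fplus n r (u n r j) (u n r i) =
    HahnSeries.single (uExp j) 1 + HahnSeries.single (uExp i) 1 +
      HahnSeries.single (βExp r + uExp i + uExp j) 1 := by
  simp only [fplus, u_eq, β_eq, HahnSeries.single_mul_single, one_mul]
  rw [add_right_comm (βExp r)]

theorem fplus_u_u_coeff {i j : Fin r} (h : i < j) :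
    (fplus n r (u n r j) (u n r i)).coeff (uExp j) = 1 := by
  rw [fplus_u_u, HahnSeries.coeff_add, HahnSeries.coeff_add, HahnSeries.coeff_single_same,
    HahnSeries.coeff_single_of_ne (uExp_lt_uExp h).ne, HahnSeries.coeff_single_of_ne, add_zero,
    add_zero]
  exact (lt_add_of_pos_left _ (βExp_add_uExp_pos i)).ne

theorem inv_fplus_u_u_mem {i j : Fin r} (h : i < j) :
    (fplus n r (u n r j) (u n r i))⁻¹ ∈ supportedIn (nonposDeg (uDeg i)) := by
  have hj : u n r j ∈ supportedIn (nonposDeg (uDeg i)) :=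
    constants_le _ (u_mem_constants h.ne)
  refine inv_mem_supportedIn (e := uExp j) (add_mem (add_mem hj (u_mem_supportedIn i))
    (mul_mem (mul_mem (constants_le _ (β_mem_constants i)) hj) (u_mem_supportedIn i))) ?_ ?_ ?_
  · rw [fplus_u_u_coeff h]
    exact one_ne_zero
  · intro a ha
    rw [fplus_u_u, HahnSeries.coeff_add, HahnSeries.coeff_add,
      HahnSeries.coeff_single_of_ne ha.ne, HahnSeries.coeff_single_of_ne
      (ha.trans (uExp_lt_uExp h)).ne, HahnSeries.coeff_single_of_ne
      (ha.trans (lt_add_of_pos_left _ (βExp_add_uExp_pos i))).ne, add_zero, add_zero]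
  · change uDeg i (-uExp j) ≤ 0
    rw [map_neg, uDeg_uExp_of_ne h.ne, neg_zero]

theorem fplus_u_u_ne_zero {i j : Fin r} (h : i < j) : fplus n r (u n r j) (u n r i) ≠ 0 := by
  intro h0
  have := fplus_u_u_coeff (n := n) h
  rw [h0] at this
  simp at this

theorem fplus_u_C_ne_zero (j : Fin r) (c : K n) :
    fplus n r (u n r j) (HahnSeries.C c) ≠ 0 := by
  intro h0
  have h1 : fplus n r (u n r j) (HahnSeries.C c) = HahnSeries.single (uExp j) 1 +
      HahnSeries.single 0 c + HahnSeries.single (βExp r + uExp j) c := by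
    simp only [fplus, u_eq, β_eq, HahnSeries.C_apply, HahnSeries.single_mul_single, one_mul,
      add_zero]
  have h2 := congrArg (fun f => HahnSeries.coeff f (uExp j)) (h1.symm.trans h0)
  simp only [HahnSeries.coeff_add, HahnSeries.coeff_single_same] at h2
  rw [HahnSeries.coeff_single_of_ne (uExp_neg j).ne, HahnSeries.coeff_single_of_ne
    ((uExp_neg j).trans (βExp_add_uExp_pos j)).ne] at h2
  simp at h2

theorem x_injective : Function.Injective (x n) := fun _ _ h =>
  MvPolynomial.X_injective (IsFractionRing.injective (MvPolynomial (Fin n) ℚ) (K n) h)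

end Exponents

section GeneratingFunction

variable {n r : ℕ}

/-- The part of the generating function that involves the variables `x_j`, `j ∈ A`, and `u_i`,
`k ≤ i`. -/
def partialGen (A : Finset (Fin n)) (k : ℕ) : H n r :=
  (∏ i : Fin r with k ≤ i.val, ((1 + β n r * u n r i)⁻¹ *
    ∏ j ∈ A, fplus n r (u n r i) (CK (x n j)) / fminus n r (u n r i) (CK (x n j)))) *
  ∏ i : Fin r with k ≤ i.val, ∏ j ∈ Finset.Ioi i,
    fminus n r (u n r j) (u n r i) / fplus n r (u n r j) (u n r i)

/-- The residue factor of `x_a` relative to the variables `x_b`, `b ∈ B`. -/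
def residueFactor (n r m : ℕ) (a : Fin n) (B : Finset (Fin n)) : H n r :=
  fplus n r (CK (x n a)) (CK (x n a)) * (CK (x n a) : H n r) ^ (m - 1) *
    ∏ b ∈ B, fplus n r (CK (x n a)) (CK (x n b)) / fminus n r (CK (x n a)) (CK (x n b))

theorem filter_succ_le_eq_Ioi (i : Fin r) :
    ({l : Fin r | (i : ℕ) + 1 ≤ l} : Finset (Fin r)) = Finset.Ioi i := by
  ext l
  simp only [Finset.mem_filter, Finset.mem_univ, true_and, Finset.mem_Ioi, Fin.lt_def,
    Nat.succ_le_iff]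

theorem filter_le_eq_insert (i : Fin r) :
    ({l : Fin r | (i : ℕ) ≤ l} : Finset (Fin r)) = insert i (Finset.Ioi i) := by
  ext l
  simp only [Finset.mem_filter, Finset.mem_univ, true_and, Finset.mem_insert, Finset.mem_Ioi,
    Fin.lt_def, Fin.ext_iff]
  omega

theorem partialGen_eq_mul (A : Finset (Fin n)) (i : Fin r) :
    (partialGen A i : H n r) = (1 + β n r * u n r i)⁻¹ *
      (∏ j ∈ A, fplus n r (u n r i) (CK (x n j)) / fminus n r (u n r i) (CK (x n j))) *
      (∏ j ∈ Finset.Ioi i, fminus n r (u n r j) (u n r i) / fplus n r (u n r j) (u n r i)) *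
      partialGen A (i + 1) := by
  rw [partialGen, partialGen, filter_succ_le_eq_Ioi, filter_le_eq_insert,
    Finset.prod_insert (by simp), Finset.prod_insert (by simp)]
  ring

theorem partialGen_mem_constants (A : Finset (Fin n)) (i : Fin r) :
    (partialGen A (i + 1) : H n r) ∈ constants (uDeg i) := by
  have hu : ∀ l ∈ Finset.Ioi i, u n r l ∈ constants (uDeg i) := fun l hl =>
    u_mem_constants (Finset.mem_Ioi.1 hl).ne
  have hx : ∀ a, (CK (x n a) : H n r) ∈ constants (uDeg i) := fun a => C_mem_constants _ _
  rw [partialGen, filter_succ_le_eq_Ioi]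
  refine mul_mem (prod_mem fun l hl => mul_mem (inv_mem (one_add_β_mul_mem_constants (hu l hl)))
    (prod_mem fun j _ => ?_)) (prod_mem fun l hl => prod_mem fun j hj => ?_)
  · exact div_mem (fplus_mem_constants (hu l hl) (hx j)) (fminus_mem_constants (hu l hl) (hx j))
  · have hj : j ∈ Finset.Ioi i :=
      Finset.mem_Ioi.2 ((Finset.mem_Ioi.1 hl).trans (Finset.mem_Ioi.1 hj))
    exact div_mem (fminus_mem_constants (hu j hj) (hu l hl))
      (fplus_mem_constants (hu j hj) (hu l hl))

theorem fminus_u_C_ne_zero (j : Fin r) (c : K n) :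
    fminus n r (u n r j) (HahnSeries.C c) ≠ 0 :=
  div_ne_zero (single_sub_C_ne_zero (uExp_neg j) c) (one_add_β_mul_C_ne_zero c)

theorem partialGen_mul_eq_erase {A : Finset (Fin n)} {a : Fin n} (ha : a ∈ A) (i : Fin r) :
    (∏ j ∈ Finset.Ioi i, fminus n r (u n r j) (CK (x n a)) / fplus n r (u n r j) (CK (x n a))) *
      partialGen A (i + 1) = (partialGen (A.erase a) (i + 1) : H n r) := by
  rw [partialGen, partialGen, ← mul_assoc, filter_succ_le_eq_Ioi, ← Finset.prod_mul_distrib]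
  refine congrArg (· * _) (Finset.prod_congr rfl fun l _ => ?_)
  rw [← Finset.mul_prod_erase A _ ha]
  have h1 := fplus_u_C_ne_zero l (x n a)
  have h2 := fminus_u_C_ne_zero l (x n a)
  field_simp

/-- The regular part, as a function of `v = u_i`, of the generating function times `v ^ (m - 1)`. -/
def regularPart (A : Finset (Fin n)) (i : Fin r) (m : ℕ) (v : H n r) : H n r :=
  v ^ (m - 1) * (1 + β n r * v)⁻¹ *
    (∏ b ∈ A, fplus n r v (CK (x n b)) * (1 + β n r * CK (x n b))) *
    ∏ j ∈ Finset.Ioi i, fminus n r (u n r j) v / fplus n r (u n r j) v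

theorem specializesTo_regularPart (A : Finset (Fin n)) (i : Fin r) (m : ℕ) (y : K n) :
    SpecializesTo (supportedIn (nonposDeg (uDeg i))) (constants (uDeg i)) (u n r i)
      (HahnSeries.C y) (regularPart A i m (u n r i)) (regularPart A i m (HahnSeries.C y)) := by
  have hSR := constants_le (F := K n) (uDeg i)
  have hx : ∀ b, (CK (x n b) : H n r) ∈ constants (uDeg i) := fun b => C_mem_constants _ _
  have hβ := β_mem_constants (n := n) i
  have hself := SpecializesTo.self (R := supportedIn (nonposDeg (uDeg i)))
    (u_mem_supportedIn (n := n) i) (C_mem_constants (uDeg i) y)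
  have hplus := (SpecializesTo.const (t := u n r i) (X := HahnSeries.C y) hSR
    (one_mem _)).add ((SpecializesTo.const hSR hβ).mul hSR hself)
  have hplus' := hplus.inv hSR (one_add_β_mul_u_ne_zero i) (one_add_β_mul_C_ne_zero _)
    (inv_one_add_β_mul_u_mem i)
  refine (((hself.pow hSR _).mul hSR hplus').mul hSR (SpecializesTo.prod hSR fun b _ => ?_)).mul
    hSR (SpecializesTo.prod hSR fun j hj => ?_)
  · refine SpecializesTo.mul hSR ?_
      (SpecializesTo.const hSR (one_add_β_mul_mem_constants (hx b)))
    exact (hself.add (SpecializesTo.const hSR (hx b))).add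
      (((SpecializesTo.const hSR hβ).mul hSR hself).mul hSR (SpecializesTo.const hSR (hx b)))
  · have hij := Finset.mem_Ioi.1 hj
    have huj := SpecializesTo.const (t := u n r i) (X := HahnSeries.C y) hSR
      (u_mem_constants (n := n) hij.ne)
    have hden := (huj.add hself).add (((SpecializesTo.const hSR hβ).mul hSR huj).mul hSR hself)
    simp only [div_eq_mul_inv, fminus]
    exact ((huj.sub hself).mul hSR hplus').mul hSR
      (hden.inv hSR (fplus_u_u_ne_zero hij) (fplus_u_C_ne_zero _ _) (inv_fplus_u_u_mem hij))

theorem u_mul_regularPart_div (A : Finset (Fin n)) (i : Fin r) {m : ℕ} (hm : 0 < m) (c : H n r) :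
    u n r i * (regularPart A i m (u n r i) * (c * partialGen A (i + 1)) /
      ∏ b ∈ A, (u n r i - CK (x n b))) = u n r i ^ m * (c * partialGen A i) := by
  obtain ⟨m, rfl⟩ := Nat.exists_eq_succ_of_ne_zero hm.ne'
  have h : ∏ j ∈ A, fplus n r (u n r i) (CK (x n j)) / fminus n r (u n r i) (CK (x n j)) =
      (∏ b ∈ A, fplus n r (u n r i) (CK (x n b)) * (1 + β n r * CK (x n b))) /
        ∏ b ∈ A, (u n r i - CK (x n b)) := by
    rw [← Finset.prod_div_distrib]
    refine Finset.prod_congr rfl fun j _ => ?_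
    rw [fminus, div_div_eq_mul_div]
  rw [partialGen_eq_mul, h, regularPart, Nat.succ_eq_add_one, Nat.add_sub_cancel, pow_succ]
  ring

theorem regularPart_div {A : Finset (Fin n)} {a : Fin n} (ha : a ∈ A) (i : Fin r) (m : ℕ)
    (c : H n r) :
    regularPart A i m (CK (x n a)) * (c * partialGen A (i + 1)) /
      ∏ b ∈ A.erase a, (CK (x n a) - CK (x n b)) =
    c * (residueFactor n r m a (A.erase a) * partialGen (A.erase a) (i + 1)) := by
  have h : ∏ b ∈ A.erase a, fplus n r (CK (x n a)) (CK (x n b)) /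
      fminus n r (CK (x n a)) (CK (x n b)) =
      (∏ b ∈ A.erase a, fplus n r (CK (x n a)) (CK (x n b)) * (1 + β n r * CK (x n b))) /
        ∏ b ∈ A.erase a, (CK (x n a) - CK (x n b)) := by
    rw [← Finset.prod_div_distrib]
    refine Finset.prod_congr rfl fun j _ => ?_
    rw [fminus, div_div_eq_mul_div]
  have h1 := one_add_β_mul_C_ne_zero (r := r) (x n a)
  rw [← partialGen_mul_eq_erase ha, residueFactor, h, regularPart,
    ← Finset.mul_prod_erase A _ ha]
  generalize ∏ b ∈ A.erase a, ((CK (x n a) : H n r) - CK (x n b)) = D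
  field_simp

theorem coeff_mul_partialGen (A : Finset (Fin n)) (i : Fin r) {m : ℕ} (hm : 0 < m) {c : H n r}
    (hc : c ∈ constants (uDeg i)) (d : ℤ) (g : Fin r → ℤ) (hg : g i = m) :
    (c * partialGen A i).coeff (eVec r d g) =
      ∑ a ∈ A, (c * (residueFactor n r m a (A.erase a) *
        partialGen (A.erase a) (i + 1))).coeff (eVec r d (Function.update g i 0)) := by
  have hSR := constants_le (F := K n) (uDeg i)
  have hspec : ∀ y : K n, SpecializesTo (supportedIn (nonposDeg (uDeg i))) (constants (uDeg i))
      (u n r i) (HahnSeries.C y) (regularPart A i m (u n r i) * (c * partialGen A (i + 1)))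
      (regularPart A i m (HahnSeries.C y) * (c * partialGen A (i + 1))) := fun y =>
    (specializesTo_regularPart A i m y).mul hSR
      (SpecializesTo.const hSR (mul_mem hc (partialGen_mem_constants A i)))
  have hcoeff : (c * partialGen A i).coeff (eVec r d g) =
      (u n r i ^ m * (c * partialGen A i)).coeff (eVec r d (Function.update g i 0)) := by
    rw [← eVec_add_nsmul_uExp i d g m hg, add_comm (m • uExp i), u_eq, HahnSeries.single_pow,
      HahnSeries.coeff_single_mul_add, one_pow, one_mul]
  rw [hcoeff, ← u_mul_regularPart_div A i hm c, u_eq]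
  refine (coeff_eq_sum_residues (uExp_neg i) (uDeg_uExp_self i) x_injective
    (hspec 0).1 (fun a _ => hspec (x n a)) (by simp)).trans ?_
  rw [HahnSeries.coeff_sum]
  exact Finset.sum_congr rfl fun a ha => by rw [regularPart_div ha]

theorem residueFactor_mem_constants (i : Fin r) (m : ℕ) (a : Fin n) (B : Finset (Fin n)) :
    residueFactor n r m a B ∈ constants (uDeg i) := by
  have hx : ∀ b, (CK (x n b) : H n r) ∈ constants (uDeg i) := fun b => C_mem_constants _ _
  exact mul_mem (mul_mem (fplus_mem_constants (hx a) (hx a)) (pow_mem (hx a) _))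
    (prod_mem fun b _ => div_mem (fplus_mem_constants (hx a) (hx b))
      (fminus_mem_constants (hx a) (hx b)))

theorem coeff_mul_partialGen_eq_selectionSum (nu : ℕ → ℕ) (hpos : ∀ k < r, 0 < nu k) (d : ℤ)
    (s k : ℕ) (hk : k + s = r) (A : Finset (Fin n)) {c : H n r}
    (hc : ∀ i : Fin r, c ∈ constants (uDeg i)) :
    (c * partialGen A k).coeff (eVec r d fun i => if k ≤ i.val then (nu i : ℤ) else 0) =
      (c * selectionSum (fun l => residueFactor n r (nu l)) s k A).coeff
        (eVec r d fun _ => 0) := by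
  induction s generalizing k A c with
  | zero =>
    have h : ∀ i : Fin r, ¬ k ≤ i.val := fun i => by have := i.isLt; omega
    simp [partialGen, selectionSum, h]
  | succ s ih =>
    have hkr : k < r := by omega
    have hupd : Function.update (fun i : Fin r => if k ≤ i.val then (nu i : ℤ) else 0)
        ⟨k, hkr⟩ 0 = fun i : Fin r => if k + 1 ≤ i.val then (nu i : ℤ) else 0 := by
      funext i
      by_cases hi : i = ⟨k, hkr⟩
      · subst hi
        simp
      · have : i.val ≠ k := fun h => hi (Fin.ext h)
        rw [Function.update_of_ne hi]
        congr 1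
        rw [eq_iff_iff]
        omega
    rw [selectionSum, Finset.mul_sum, HahnSeries.coeff_sum]
    refine (coeff_mul_partialGen A ⟨k, hkr⟩ (hpos k hkr) (hc _) d _ (by simp)).trans ?_
    refine Finset.sum_congr rfl fun a _ => ?_
    rw [hupd, ← mul_assoc, ← mul_assoc]
    exact ih (k + 1) (by omega) (A.erase a) fun i =>
      mul_mem (hc i) (residueFactor_mem_constants i _ _ _)

end GeneratingFunction

/-- **Generating function for the `K`-theoretic `Q`-polynomials (multiplicative
specialization of the universal Schur `Q`-functions).**

For a strict partition `ν_1 > ⋯ > ν_r > 0` of length `r ≤ n`,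
`GQ_ν(x_n) = Σ_{w∈C(r,n)} w·( ∏_i (x_i ⊕ x_i) x_i^{ν_i−1}
  · ∏_i ∏_{j=i+1}^n (x_i ⊕ x_j)/(x_i ⊖ x_j) )`
equals, as an element of `Λ[[β]]` (i.e. coefficientwise in `β`), the coefficient of
`u_1^{−ν_1}⋯u_r^{−ν_r}` in
`∏_i ( (1/(1+βu_i)) ∏_{j=1}^n (u_i ⊕ x_j)/(u_i ⊖ x_j) )
  · ∏_{1≤i<j≤r} (u_j ⊖ u_i)/(u_j ⊕ u_i)`. -/
theorem K_theoretic_Q_generating_function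
    (n r : ℕ) (hr : 1 ≤ r) (hrn : r ≤ n)
    (nu : Fin r → ℕ) (hpos : ∀ i, 0 < nu i)
    (hstrict : ∀ i j : Fin r, i < j → nu j < nu i) :
    ∀ d : ℤ,
    (∑ w ∈ Cperm r n,
      (∏ i : Fin r,
        fplus n r (CK (x n (w (Fin.castLE hrn i)))) (CK (x n (w (Fin.castLE hrn i)))) *
          (CK (x n (w (Fin.castLE hrn i))) : H n r) ^ (nu i - 1)) *
      (∏ i : Fin r, ∏ j ∈ Finset.Ioi (Fin.castLE hrn i),
          fplus n r (CK (x n (w (Fin.castLE hrn i)))) (CK (x n (w j))) /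
          fminus n r (CK (x n (w (Fin.castLE hrn i)))) (CK (x n (w j))))).coeff
        (eVec r d (fun _ => 0))
    =
    ((∏ i : Fin r,
        ((1 + β n r * u n r i)⁻¹ *
          ∏ j : Fin n,
            fplus n r (u n r i) (CK (x n j)) / fminus n r (u n r i) (CK (x n j)))) *
      (∏ i : Fin r, ∏ j ∈ Finset.Ioi i,
          fminus n r (u n r j) (u n r i) / fplus n r (u n r j) (u n r i))).coeff
        (eVec r d (fun k => (nu k : ℤ))) := by
  intro d
  set nu' : ℕ → ℕ := fun k => if h : k < r then nu ⟨k, h⟩ else 0 with hnu'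
  have hnu : ∀ i : Fin r, nu' i = nu i := fun i => by simp [hnu']
  have hmain := coeff_mul_partialGen_eq_selectionSum (n := n) nu'
    (fun k hk => by simpa [hnu', hk] using hpos ⟨k, hk⟩) d r 0 (Nat.zero_add r) Finset.univ
    (c := 1) (fun i => one_mem _)
  simp only [one_mul, Nat.zero_le, if_true, hnu] at hmain
  have hgen : (partialGen Finset.univ 0 : H n r) = (∏ i : Fin r,
        ((1 + β n r * u n r i)⁻¹ *
          ∏ j : Fin n,
            fplus n r (u n r i) (CK (x n j)) / fminus n r (u n r i) (CK (x n j)))) *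
      (∏ i : Fin r, ∏ j ∈ Finset.Ioi i,
          fminus n r (u n r j) (u n r i) / fplus n r (u n r j) (u n r i)) := by
    simp [partialGen]
  rw [← hgen, hmain, selectionSum_eq_sum_injective]
  simp only [Finset.mem_univ, implies_true, and_true, zero_add]
  rw [← sum_Cperm_eq_sum_injective hrn]
  refine congrArg (HahnSeries.coeff · _) (Finset.sum_congr rfl fun w _ => ?_)
  rw [← Finset.prod_mul_distrib]
  refine Finset.prod_congr rfl fun i _ => ?_
  rw [residueFactor, hnu]
  refine congrArg (HMul.hMul (α := H n r) _) (Finset.prod_equiv w (fun j => ?_) fun _ _ => rfl)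
  simp only [Finset.mem_Ioi, Finset.mem_filter, Finset.mem_univ, true_and, ne_eq,
    w.injective.eq_iff]
  constructor
  · rintro h l hl rfl
    exact absurd h (not_lt.2 hl)
  · intro h
    by_contra hj
    have hj : j.val ≤ i.val := not_lt.1 hj
    exact h ⟨j, hj.trans_lt i.isLt⟩ hj rfl
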